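/- Let Ω ⊂ ℝⁿ be a bounded domain with Lipschitz boundary, and suppose β > α ≥ 0, β ≥ 2, α + β = n, and 1 ≤ p < 2β. Then there exists C = C(p, α, β, Ω) > 0 such that for all u ∈ C²(Ω̄) with u and ∇u vanishing on ∂Ω and every i ∈ {1,…,n}, ‖D_i u‖_{L^p(Ω)} ≤ C ( [u]_{S̊₂} + 1 ), where [u]_{S̊₂} := ( ∑_{i=1}^n ∫_Ω |u|^α |D_i² u|^β dx )^{1/(α+β)}. In particular the embedding S̊_{2,α,β}(Ω) ⊂ W₀^{1,p}(Ω) holds. -/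

import Mathlib

open MeasureTheory Real Set

open Filter Topology

section Regularity

variable {E : Type*} [NormedAddCommGroup E] [NormedSpace ℝ E] {Ω : Set E} {u : E → ℝ}

/-- Derivatives of a function of class `C^m` on the compact closure of an open set are bounded. -/
lemma exists_bound_iteratedFDeriv {m : ℕ} (hΩ : IsOpen Ω) (hc : IsCompact (closure Ω))
    (hu : ContDiffOn ℝ m u (closure Ω)) {k : ℕ} (hk : k ≤ m) :
    ∃ M : ℝ, ∀ x ∈ Ω, ‖iteratedFDeriv ℝ k u x‖ ≤ M := by
  suffices H : ∃ M : ℝ, ∀ x ∈ closure Ω ∩ Ω, ‖iteratedFDeriv ℝ k u x‖ ≤ M by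
    obtain ⟨M, hM⟩ := H
    exact ⟨M, fun x hx => hM x ⟨subset_closure hx, hx⟩⟩
  refine hc.induction_on (p := fun s => ∃ M : ℝ, ∀ x ∈ s ∩ Ω, ‖iteratedFDeriv ℝ k u x‖ ≤ M)
    ⟨0, by simp⟩ ?_ ?_ ?_
  · rintro s t hst ⟨M, hM⟩
    exact ⟨M, fun x hx => hM x ⟨hst hx.1, hx.2⟩⟩
  · rintro s t ⟨M, hM⟩ ⟨N, hN⟩
    refine ⟨max M N, ?_⟩
    rintro x ⟨hx | hx, hxΩ⟩
    · exact (hM x ⟨hx, hxΩ⟩).trans (le_max_left _ _)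
    · exact (hN x ⟨hx, hxΩ⟩).trans (le_max_right _ _)
  · intro x hx
    obtain ⟨v, hv, p, hp⟩ := (contDiffWithinAt_nat.1 (hu x hx))
    rw [insert_eq_of_mem hx] at hv
    obtain ⟨O, hO, hxO, hOv⟩ := mem_nhdsWithin.1 hv
    have hsub : O ∩ Ω ⊆ v := fun y hy => hOv ⟨hy.1, subset_closure hy.2⟩
    have hopen : IsOpen (O ∩ Ω) := hO.inter hΩ
    have hcont := hp.cont k (by exact_mod_cast hk) x (hOv ⟨hxO, hx⟩)
    have hb : ∀ᶠ y in 𝓝[v] x, ‖p y k‖ < ‖p x k‖ + 1 :=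
      hcont.norm.eventually (gt_mem_nhds (lt_add_one _))
    obtain ⟨O', hO', hxO', hO'v⟩ := mem_nhdsWithin.1 hb
    refine ⟨closure Ω ∩ (O ∩ O'), inter_mem_nhdsWithin _ ((hO.inter hO').mem_nhds ⟨hxO, hxO'⟩),
      ‖p x k‖ + 1, ?_⟩
    rintro y ⟨⟨-, hyO, hyO'⟩, hyΩ⟩
    have h1 := (hp.mono hsub).eq_iteratedFDerivWithin_of_uniqueDiffOn
      (show ((k : ℕ) : WithTop ℕ∞) ≤ m by exact_mod_cast hk) hopen.uniqueDiffOn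
      (show y ∈ O ∩ Ω from ⟨hyO, hyΩ⟩)
    rw [iteratedFDerivWithin_of_isOpen k hopen ⟨hyO, hyΩ⟩] at h1
    rw [← h1]
    exact (hO'v ⟨hyO', hsub ⟨hyO, hyΩ⟩⟩).le

/-- The gradient vanishes almost everywhere on the zero set. -/
lemma ae_fderiv_eq_zero_of_eq_zero [FiniteDimensional ℝ E] [MeasurableSpace E] [BorelSpace E]
    (μ : Measure E) [μ.IsAddHaarMeasure] (hΩ : IsOpen Ω) (hu : DifferentiableOn ℝ u Ω) :
    ∀ᵐ x ∂μ.restrict Ω, u x = 0 → fderiv ℝ u x = 0 := by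
  rcases subsingleton_or_nontrivial E with hE | hE
  · exact Eventually.of_forall fun x _ => Subsingleton.elim _ _
  obtain ⟨e, he⟩ := exists_ne (0 : E)
  set s : Set E := Ω ∩ {x | u x = 0} with hs
  have hsm : MeasurableSet s := by
    have : s = Ω \ (Ω ∩ u ⁻¹' {0}ᶜ) := by ext; simp [hs]
    rw [this]
    exact hΩ.measurableSet.diff
      (hu.continuousOn.isOpen_inter_preimage hΩ isOpen_compl_singleton).measurableSet
  have happ : ApproximatesLinearOn (fun x => u x • e) (0 : E →L[ℝ] E) s 0 := by
    intro x hx y hy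
    have hx' : u x = 0 := hx.2
    have hy' : u y = 0 := hy.2
    simp [hx', hy']
  have h := happ.norm_fderiv_sub_le μ hsm (fun x => (fderiv ℝ u x).smulRight e) (fun x hx =>
    (((hu x hx.1).differentiableAt (hΩ.mem_nhds hx.1)).hasFDerivAt.smul_const e).hasFDerivWithinAt)
  rw [ae_restrict_iff' hsm] at h
  rw [ae_restrict_iff' hΩ.measurableSet]
  filter_upwards [h] with x hx hxΩ hx0
  have h0 := hx ⟨hxΩ, hx0⟩
  simpa [he] using h0

lemma memLp_comp_of_bounded [FiniteDimensional ℝ E] [MeasurableSpace E] [BorelSpace E]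
    {μ : Measure E} [IsFiniteMeasureOnCompacts μ] {G : Type*} [NormedAddCommGroup G]
    [ProperSpace G] (hΩ : IsOpen Ω) (hb : Bornology.IsBounded Ω) {f : E → G}
    (hf : ContinuousOn f Ω) (hM : ∃ M : ℝ, ∀ x ∈ Ω, ‖f x‖ ≤ M) {Φ : G → ℝ} (hΦ : Continuous Φ)
    (p : ENNReal) : MemLp (fun x => Φ (f x)) p (μ.restrict Ω) := by
  obtain ⟨M, hM⟩ := hM
  obtain ⟨K, hK⟩ := (isCompact_closedBall (0 : G) M).exists_bound_of_continuousOn hΦ.continuousOn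
  have : ProperSpace E := FiniteDimensional.proper ℝ E
  have : IsFiniteMeasure (μ.restrict Ω) := ⟨by simpa using hb.measure_lt_top⟩
  exact MemLp.of_bound ((hΦ.comp_continuousOn hf).aestronglyMeasurable hΩ.measurableSet) K
    ((ae_restrict_iff' hΩ.measurableSet).2 (Eventually.of_forall fun x hx =>
      hK _ (by simpa using hM x hx)))

end Regularity

section Truncation

lemma hasDerivAt_abs_rpow_mul_self {m : ℝ} (hm : 0 < m) (t : ℝ) :
    HasDerivAt (fun t : ℝ => |t| ^ m * t) ((m + 1) * |t| ^ m) t := by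
  rcases eq_or_ne t 0 with rfl | ht
  · rw [hasDerivAt_iff_tendsto_slope]
    have h : Tendsto (fun t : ℝ => |t| ^ m) (𝓝[≠] 0) (𝓝 ((m + 1) * |(0 : ℝ)| ^ m)) := by
      have : Continuous fun t : ℝ => |t| ^ m := continuous_abs.rpow_const fun _ => Or.inr hm.le
      have h2 := this.tendsto 0
      simp only [abs_zero, zero_rpow hm.ne', mul_zero] at h2 ⊢
      exact h2.mono_left nhdsWithin_le_nhds
    refine h.congr' ?_
    filter_upwards [self_mem_nhdsWithin] with s hs
    have hs' : s ≠ 0 := hs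
    simp [slope_def_field, hs']
  · have h := ((hasDerivAt_abs ht).rpow_const (p := m) (Or.inl (abs_ne_zero.2 ht))).mul
      (hasDerivAt_id t)
    refine h.congr_deriv ?_
    have h1 : |t| ^ m = |t| ^ (m - 1) * |t| := by
      rw [← rpow_add_one (abs_ne_zero.2 ht)]; ring_nf
    have h2 : (SignType.sign t : ℝ) * t = |t| := sign_mul_self t
    rw [h1, ← h2, id]; ring

/-- A smooth function which vanishes near `0` and agrees with the identity away from `0`. -/
lemma exists_truncation : ∃ h : ℝ → ℝ, ∃ K : ℝ, ContDiff ℝ 1 h ∧ (∀ t, |t| < 1 → h t = 0) ∧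
    (∀ t, |h t| ≤ |t|) ∧ (∀ t, |deriv h t| ≤ K) ∧ ∀ t, 2 < |t| → h t = t ∧ deriv h t = 1 := by
  set h : ℝ → ℝ := fun t => t * smoothTransition (t ^ 2 - 1) with hh
  have hC : ContDiff ℝ 1 h := by
    refine contDiff_id.mul ((smoothTransition.contDiff (n := 1)).comp ?_)
    fun_prop
  have h2 : ∀ t, 2 < |t| → h t = t := by
    intro t ht
    have : 1 ≤ t ^ 2 - 1 := by nlinarith [sq_abs t]
    simp [hh, smoothTransition.one_of_one_le this]
  have h3 : ∀ t, 2 < |t| → deriv h t = 1 := by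
    intro t ht
    have : h =ᶠ[𝓝 t] id := by
      filter_upwards [continuous_abs.continuousAt.eventually (lt_mem_nhds ht)] with s hs
      exact h2 s hs
    rw [this.deriv_eq]; simp
  obtain ⟨K, hK⟩ := (isCompact_closedBall (0 : ℝ) 2).exists_bound_of_continuousOn
    (hC.continuous_deriv le_rfl).continuousOn
  refine ⟨h, max K 1, hC, ?_, ?_, ?_, fun t ht => ⟨h2 t ht, h3 t ht⟩⟩
  · intro t ht
    have : t ^ 2 - 1 ≤ 0 := by nlinarith [sq_abs t, abs_nonneg t]
    simp [hh, smoothTransition.zero_of_nonpos this]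
  · intro t
    change |t * smoothTransition (t ^ 2 - 1)| ≤ |t|
    rw [abs_mul]
    exact mul_le_of_le_one_right (abs_nonneg _) (by
      rw [abs_of_nonneg (smoothTransition.nonneg _)]; exact smoothTransition.le_one _)
  · intro t
    rcases le_or_gt |t| 2 with ht | ht
    · exact (hK t (by simpa using ht)).trans (le_max_left _ _)
    · rw [h3 t ht]; simp

lemma tendsto_abs_natCast_add_one_mul {t : ℝ} (ht : t ≠ 0) :
    Tendsto (fun k : ℕ => |(k + 1 : ℝ) * t|) atTop atTop := by
  simp only [abs_mul]
  exact (tendsto_abs_atTop_atTop.comp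
    (tendsto_atTop_add_const_right _ _ tendsto_natCast_atTop_atTop)).atTop_mul_const (abs_pos.2 ht)

end Truncation

section Jets

variable {E : Type*} [NormedAddCommGroup E] [NormedSpace ℝ E] {Ω : Set E} {u : E → ℝ}

lemma contDiffOn_fderiv_apply (hΩ : IsOpen Ω) (hu : ContDiffOn ℝ 2 u Ω) (e : E) :
    ContDiffOn ℝ 1 (fun x => fderiv ℝ u x e) Ω :=
  (hu.fderiv_of_isOpen hΩ (by norm_num)).clm_apply contDiffOn_const

lemma continuousOn_jet (hΩ : IsOpen Ω) (hu : ContDiffOn ℝ 2 u (closure Ω)) (e : E) :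
    ContinuousOn (fun x => (u x, fderiv ℝ u x e,
      fderiv ℝ (fun y => fderiv ℝ u y e) x e)) Ω := by
  have hu' := hu.mono subset_closure
  have h1 := contDiffOn_fderiv_apply hΩ hu' e
  have h2 : ContinuousOn (fun x => fderiv ℝ (fun y => fderiv ℝ u y e) x e) Ω :=
    (h1.continuousOn_fderiv_of_isOpen hΩ le_rfl).clm_apply continuousOn_const
  exact hu'.continuousOn.prodMk (h1.continuousOn.prodMk h2)

lemma exists_bound_jet (hΩ : IsOpen Ω) (hc : IsCompact (closure Ω))
    (hu : ContDiffOn ℝ 2 u (closure Ω)) (e : E) :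
    ∃ M : ℝ, ∀ x ∈ Ω, ‖(u x, fderiv ℝ u x e,
      fderiv ℝ (fun y => fderiv ℝ u y e) x e)‖ ≤ M := by
  obtain ⟨M₀, h₀⟩ := exists_bound_iteratedFDeriv (m := 2) hΩ hc hu (k := 0) (by norm_num)
  obtain ⟨M₁, h₁⟩ := exists_bound_iteratedFDeriv (m := 2) hΩ hc hu (k := 1) (by norm_num)
  obtain ⟨M₂, h₂⟩ := exists_bound_iteratedFDeriv (m := 2) hΩ hc hu (k := 2) le_rfl
  have hu' := hu.mono subset_closure
  refine ⟨max M₀ (max (M₁ * ‖e‖) (M₂ * ‖e‖ * ‖e‖)), fun x hx => ?_⟩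
  rw [Prod.norm_mk, Prod.norm_mk]
  refine max_le_max ?_ (max_le_max ?_ ?_)
  · simpa using h₀ x hx
  · refine ((fderiv ℝ u x).le_opNorm e).trans ?_
    gcongr
    simpa [norm_iteratedFDeriv_one] using h₁ x hx
  · have hd : DifferentiableAt ℝ (fderiv ℝ u) x :=
      ((hu'.fderiv_of_isOpen hΩ (m := 1) (by norm_num)).differentiableOn
        one_ne_zero).differentiableAt (hΩ.mem_nhds hx)
    have he : fderiv ℝ (fun y => fderiv ℝ u y e) x e = fderiv ℝ (fderiv ℝ u) x e e := by
      rw [fderiv_clm_apply hd (differentiableAt_const e)]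
      simp
    have hM : ‖fderiv ℝ (fderiv ℝ u) x‖ ≤ M₂ := by
      rw [← norm_iteratedFDeriv_one, norm_iteratedFDeriv_fderiv]
      exact h₂ x hx
    rw [he]
    refine ((fderiv ℝ (fderiv ℝ u) x e).le_opNorm e).trans ?_
    gcongr
    refine ((fderiv ℝ (fderiv ℝ u) x).le_opNorm e).trans ?_
    gcongr

lemma memLp_comp_jet [FiniteDimensional ℝ E] [MeasurableSpace E] [BorelSpace E]
    {μ : Measure E} [IsFiniteMeasureOnCompacts μ] (hΩ : IsOpen Ω) (hb : Bornology.IsBounded Ω)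
    (hu : ContDiffOn ℝ 2 u (closure Ω)) (e : E) {Φ : ℝ × ℝ × ℝ → ℝ} (hΦ : Continuous Φ)
    (p : ENNReal) : MemLp (fun x => Φ (u x, fderiv ℝ u x e,
      fderiv ℝ (fun y => fderiv ℝ u y e) x e)) p (μ.restrict Ω) := by
  have : ProperSpace E := FiniteDimensional.proper ℝ E
  exact memLp_comp_of_bounded hΩ hb (continuousOn_jet hΩ hu e)
    (exists_bound_jet hΩ hb.isCompact_closure hu e) hΦ p

/-- Truncating near the zero set gives `C¹` functions compactly supported in `Ω`. -/
lemma contDiff_truncation {h : ℝ → ℝ} (hC : ContDiff ℝ 1 h) (h0 : ∀ t, |t| < 1 → h t = 0)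
    (hΩ : IsOpen Ω) (hu : ContDiffOn ℝ 2 u (closure Ω)) (hz : ∀ x ∈ frontier Ω, u x = 0)
    {c : ℝ} (hc : 0 < c) :
    ContDiff ℝ 1 (fun x => c⁻¹ * h (c * Ω.indicator u x)) ∧
    (∀ x ∈ Ω, fderiv ℝ (fun x => c⁻¹ * h (c * Ω.indicator u x)) x =
      deriv h (c * u x) • fderiv ℝ u x) ∧
    (∀ x ∉ Ω, fderiv ℝ (fun x => c⁻¹ * h (c * Ω.indicator u x)) x = 0) ∧
    tsupport (fun x => c⁻¹ * h (c * Ω.indicator u x)) ⊆ Ω := by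
  set w := fun x => c⁻¹ * h (c * Ω.indicator u x) with hw
  have hu' := hu.mono subset_closure
  have hcont : Continuous (Ω.indicator u) := continuous_indicator hz hu.continuousOn
  have hin : ∀ x ∈ Ω, w =ᶠ[𝓝 x] fun x => c⁻¹ * h (c * u x) := by
    intro x hx
    filter_upwards [hΩ.mem_nhds hx] with y hy
    simp [hw, indicator_of_mem hy]
  have hout : ∀ x ∉ Ω, w =ᶠ[𝓝 x] fun _ => 0 := by
    intro x hx
    have h1 : Continuous fun x => |c * Ω.indicator u x| := by fun_prop
    have h2 : |c * Ω.indicator u x| < 1 := by simp [indicator_of_notMem hx]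
    filter_upwards [h1.continuousAt.eventually (gt_mem_nhds h2)] with y hy
    simp [hw, h0 _ hy]
  refine ⟨?_, ?_, ?_, ?_⟩
  · rw [contDiff_iff_contDiffAt]
    intro x
    by_cases hx : x ∈ Ω
    · refine ContDiffAt.congr_of_eventuallyEq ?_ (hin x hx)
      have hux : ContDiffAt ℝ 1 u x :=
        ((hu' x hx).contDiffAt (hΩ.mem_nhds hx)).of_le (by norm_num)
      exact contDiffAt_const.mul (hC.contDiffAt.comp x (contDiffAt_const.mul hux))
    · exact contDiffAt_const.congr_of_eventuallyEq (hout x hx)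
  · intro x hx
    rw [(hin x hx).fderiv_eq]
    have hux : HasFDerivAt u (fderiv ℝ u x) x :=
      ((hu'.differentiableOn (by norm_num)).differentiableAt (hΩ.mem_nhds hx)).hasFDerivAt
    have hh := (hC.differentiable one_ne_zero (c * u x)).hasDerivAt
    have := (hh.comp_hasFDerivAt x (hux.const_mul c)).const_mul c⁻¹
    refine this.fderiv.trans ?_
    ext y
    simp
    field_simp
  · intro x hx
    rw [(hout x hx).fderiv_eq]; simp
  · intro x hx
    by_contra hxΩ
    exact notMem_tsupport_iff_eventuallyEq.2 (hout x hxΩ) hx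

variable [FiniteDimensional ℝ E] [MeasurableSpace E] [BorelSpace E]

/-- `∫ |∂ₑu|^(m+2) ≤ (m+1) ∫ |u| |∂ₑu|^m |∂ₑ²u|` for functions vanishing on the boundary. -/
lemma integral_abs_fderiv_rpow_le (μ : Measure E) [μ.IsAddHaarMeasure] (hΩ : IsOpen Ω)
    (hb : Bornology.IsBounded Ω) (hu : ContDiffOn ℝ 2 u (closure Ω))
    (hz : ∀ x ∈ frontier Ω, u x = 0) (e : E) {m : ℝ} (hm : 0 < m) :
    ∫ x in Ω, |fderiv ℝ u x e| ^ (m + 2) ∂μ ≤ (m + 1) * ∫ x in Ω, |u x| *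
      |fderiv ℝ u x e| ^ m * |fderiv ℝ (fun y => fderiv ℝ u y e) x e| ∂μ := by
  obtain ⟨h, K, hC, h0, hle, hK, h2⟩ := exists_truncation
  set D : E → ℝ := fun x => fderiv ℝ u x e with hD
  set H : E → ℝ := fun x => fderiv ℝ D x e with hH
  have hu' := hu.mono subset_closure
  have hint : ∀ {Φ : ℝ × ℝ × ℝ → ℝ}, Continuous Φ →
      IntegrableOn (fun x => Φ (u x, D x, H x)) Ω μ := fun hΦ =>
    memLp_one_iff_integrable.1 (memLp_comp_jet hΩ hb hu e hΦ 1)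
  have hdh : Continuous (deriv h) := hC.continuous_deriv le_rfl
  have hpm : Continuous fun t : ℝ => |t| ^ m := continuous_abs.rpow_const fun _ => Or.inr hm.le
  have hpm2 : Continuous fun t : ℝ => |t| ^ (m + 2) :=
    continuous_abs.rpow_const fun _ => Or.inr (by linarith)
  have hmul : ∀ t : ℝ, |t| ^ (m + 2) = t * (|t| ^ m * t) := by
    intro t
    rw [rpow_add' (abs_nonneg t) (by linarith), rpow_two, sq_abs]; ring
  have key : ∀ k : ℕ, ∫ x in Ω, deriv h ((k + 1 : ℝ) * u x) * |D x| ^ (m + 2) ∂μ ≤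
      (m + 1) * ∫ x in Ω, |u x| * |D x| ^ m * |H x| ∂μ := by
    intro k
    have hc : (0 : ℝ) < k + 1 := by positivity
    obtain ⟨w1, w2, w3, w4⟩ := contDiff_truncation hC h0 hΩ hu hz hc
    set w := fun x => ((k + 1 : ℝ))⁻¹ * h ((k + 1) * Ω.indicator u x) with hw
    have hwin : ∀ x ∈ Ω, w x = ((k + 1 : ℝ))⁻¹ * h ((k + 1) * u x) := fun x hx => by
      simp [hw, indicator_of_mem hx]
    have hwout : ∀ x ∉ Ω, w x = 0 := fun x hx => by
      simp [hw, indicator_of_notMem hx, h0]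
    have hrestr : ∀ {f g : E → ℝ}, (∀ x ∈ Ω, f x = g x) → (∀ x ∉ Ω, f x = 0) →
        IntegrableOn g Ω μ → Integrable f μ := by
      intro f g hin hout hg
      have : f = Ω.indicator g := by
        ext x
        by_cases hx : x ∈ Ω
        · simp [hx, hin]
        · simp [hx, hout]
      rw [this]
      exact hg.integrable_indicator hΩ.measurableSet
    have ibp := integral_bilinear_hasLineDerivAt_right_eq_neg_left_of_integrable (μ := μ)
      (f := w) (f' := fun x => fderiv ℝ w x e) (g := fun x => |D x| ^ m * D x)
      (g' := fun x => (m + 1) * |D x| ^ m * H x) (v := e) (B := ContinuousLinearMap.mul ℝ ℝ)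
      ?_ ?_ ?_ ?_ ?_
    · simp only [ContinuousLinearMap.mul_apply'] at ibp
      have e1 : ∫ x, fderiv ℝ w x e * (|D x| ^ m * D x) ∂μ =
          ∫ x in Ω, deriv h ((k + 1 : ℝ) * u x) * |D x| ^ (m + 2) ∂μ := by
        rw [← setIntegral_eq_integral_of_forall_compl_eq_zero (s := Ω)
          (fun x hx => by simp [w3 x hx])]
        refine setIntegral_congr_fun hΩ.measurableSet fun x hx => ?_
        simp only [w2 x hx, _root_.smul_apply, smul_eq_mul, hmul]
        ring
      have e2 : ∫ x, w x * ((m + 1) * |D x| ^ m * H x) ∂μ =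
          ∫ x in Ω, (((k + 1 : ℝ))⁻¹ * h ((k + 1) * u x)) * ((m + 1) * |D x| ^ m * H x) ∂μ := by
        rw [← setIntegral_eq_integral_of_forall_compl_eq_zero (s := Ω)
          (fun x hx => by simp [hwout x hx])]
        refine setIntegral_congr_fun hΩ.measurableSet fun x hx => ?_
        simp only [hwin x hx]
      rw [e1, e2] at ibp
      rw [← neg_eq_iff_eq_neg.2 ibp, ← integral_neg, ← integral_const_mul]
      refine setIntegral_mono_on ?_ ?_ hΩ.measurableSet fun x hx => ?_
      · exact hint (Φ := fun z => -((((k + 1 : ℝ))⁻¹ * h ((k + 1) * z.1)) *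
          ((m + 1) * |z.2.1| ^ m * z.2.2))) (by
            have := hC.continuous
            have h3 : Continuous fun z : ℝ × ℝ × ℝ => |z.2.1| ^ m := hpm.comp (by fun_prop)
            fun_prop)
      · exact hint (Φ := fun z => (m + 1) * (|z.1| * |z.2.1| ^ m * |z.2.2|)) (by
            have h3 : Continuous fun z : ℝ × ℝ × ℝ => |z.2.1| ^ m := hpm.comp (by fun_prop)
            fun_prop)
      · have hb1 : |((k + 1 : ℝ))⁻¹ * h ((k + 1) * u x)| ≤ |u x| := by
          rw [abs_mul, abs_inv, abs_of_pos hc, inv_mul_le_iff₀ hc]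
          refine (hle _).trans ?_
          rw [abs_mul, abs_of_pos hc]
        refine (neg_le_abs _).trans ?_
        have hpos : 0 ≤ |D x| ^ m := by positivity
        have hb2 : |(m + 1) * |D x| ^ m * H x| = (m + 1) * |D x| ^ m * |H x| := by
          rw [abs_mul, abs_mul, abs_of_pos (show 0 < m + 1 by linarith), abs_of_nonneg hpos]
        rw [abs_mul, hb2]
        calc _ ≤ |u x| * ((m + 1) * |D x| ^ m * |H x|) := by gcongr
          _ = _ := by ring
    · refine hrestr (g := fun x => deriv h ((k + 1 : ℝ) * u x) * |D x| ^ (m + 2)) ?_ ?_ ?_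
      · intro x hx
        simp only [w2 x hx, _root_.smul_apply, smul_eq_mul, hmul,
          ContinuousLinearMap.mul_apply']
        ring
      · intro x hx; simp [w3 x hx]
      · exact hint (Φ := fun z => deriv h ((k + 1 : ℝ) * z.1) * |z.2.1| ^ (m + 2)) (by
            have h3 : Continuous fun z : ℝ × ℝ × ℝ => |z.2.1| ^ (m + 2) := hpm2.comp (by fun_prop)
            fun_prop)
    · refine hrestr (g := fun x => (((k + 1 : ℝ))⁻¹ * h ((k + 1) * u x)) *
          ((m + 1) * |D x| ^ m * H x)) ?_ ?_ ?_
      · intro x hx; simp [hwin x hx]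
      · intro x hx; simp [hwout x hx]
      · exact hint (Φ := fun z => (((k + 1 : ℝ))⁻¹ * h ((k + 1) * z.1)) *
          ((m + 1) * |z.2.1| ^ m * z.2.2)) (by
            have := hC.continuous
            have h3 : Continuous fun z : ℝ × ℝ × ℝ => |z.2.1| ^ m := hpm.comp (by fun_prop)
            fun_prop)
    · refine hrestr (g := fun x => (((k + 1 : ℝ))⁻¹ * h ((k + 1) * u x)) *
          (|D x| ^ m * D x)) ?_ ?_ ?_
      · intro x hx; simp [hwin x hx]
      · intro x hx; simp [hwout x hx]
      · exact hint (Φ := fun z => (((k + 1 : ℝ))⁻¹ * h ((k + 1) * z.1)) *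
          (|z.2.1| ^ m * z.2.1)) (by
            have := hC.continuous
            have h3 : Continuous fun z : ℝ × ℝ × ℝ => |z.2.1| ^ m := hpm.comp (by fun_prop)
            fun_prop)
    · intro x _
      exact ((w1.differentiable one_ne_zero) x).hasFDerivAt.hasLineDerivAt e
    · intro x hx
      have hxΩ := w4 hx
      have hDx : HasFDerivAt D (fderiv ℝ D x) x :=
        (((contDiffOn_fderiv_apply hΩ hu' e).differentiableOn one_ne_zero).differentiableAt
          (hΩ.mem_nhds hxΩ)).hasFDerivAt
      have := ((hasDerivAt_abs_rpow_mul_self hm (D x)).comp_hasFDerivAt x hDx).hasLineDerivAt e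
      exact this
  have hlim : Tendsto (fun k : ℕ => ∫ x in Ω, deriv h ((k + 1 : ℝ) * u x) * |D x| ^ (m + 2) ∂μ)
      atTop (𝓝 (∫ x in Ω, |D x| ^ (m + 2) ∂μ)) := by
    refine tendsto_integral_of_dominated_convergence (fun x => K * |D x| ^ (m + 2)) ?_ ?_ ?_ ?_
    · intro k
      exact (hint (Φ := fun z => deriv h ((k + 1 : ℝ) * z.1) * |z.2.1| ^ (m + 2)) (by
            have h3 : Continuous fun z : ℝ × ℝ × ℝ => |z.2.1| ^ (m + 2) := hpm2.comp (by fun_prop)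
            fun_prop)).aestronglyMeasurable
    · exact hint (Φ := fun z => K * |z.2.1| ^ (m + 2)) (by
            have h3 : Continuous fun z : ℝ × ℝ × ℝ => |z.2.1| ^ (m + 2) := hpm2.comp (by fun_prop)
            fun_prop)
    · intro k
      refine Eventually.of_forall fun x => ?_
      have hpos : 0 ≤ |D x| ^ (m + 2) := by positivity
      rw [norm_mul, norm_of_nonneg hpos]
      gcongr
      exact hK _
    · filter_upwards [ae_fderiv_eq_zero_of_eq_zero μ hΩ (hu'.differentiableOn (by norm_num))]
        with x hx
      rcases eq_or_ne (u x) 0 with h3 | h3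
      · have : D x = 0 := by simp [hD, hx h3]
        simp [this, zero_rpow (show m + 2 ≠ 0 by linarith)]
      · refine tendsto_const_nhds.congr' ?_
        filter_upwards [(tendsto_abs_natCast_add_one_mul h3).eventually_gt_atTop 2] with k hk
        rw [(h2 _ hk).2, one_mul]
  exact le_of_tendsto' hlim key

end Jets

section Sobolev

lemma norm_le_sum_abs_apply_single {n : ℕ} (L : (Fin n → ℝ) →L[ℝ] ℝ) :
    ‖L‖ ≤ ∑ i, |L (Pi.single i 1)| := by
  refine L.opNorm_le_bound (Finset.sum_nonneg fun _ _ => abs_nonneg _) fun x => ?_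
  have hx : L x = ∑ i, x i * L (Pi.single i 1) := by
    conv_lhs => rw [pi_eq_sum_univ' x]
    simp [map_sum]
  rw [hx, Finset.sum_mul]
  refine (Finset.abs_sum_le_sum_abs _ _).trans (Finset.sum_le_sum fun i _ => ?_)
  rw [abs_mul, mul_comm]
  gcongr
  exact norm_le_pi_norm x i

lemma eLpNorm_ofReal_eq {α : Type*} [MeasurableSpace α] {μ : Measure α} {f : α → ℝ} {s : ℝ}
    (hs : 0 < s) (hf : MemLp f (ENNReal.ofReal s) μ) :
    eLpNorm f (ENNReal.ofReal s) μ = ENNReal.ofReal ((∫ x, |f x| ^ s ∂μ) ^ (1 / s)) := by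
  rw [hf.eLpNorm_eq_integral_rpow_norm (by simpa using hs) ENNReal.ofReal_ne_top,
    ENNReal.toReal_ofReal hs.le, one_div]
  rfl

/-- Sobolev's inequality for functions vanishing on the boundary of a bounded open set. -/
lemma exists_eLpNorm_le_eLpNorm_fderiv {E : Type*} [NormedAddCommGroup E] [NormedSpace ℝ E]
    [FiniteDimensional ℝ E] [MeasurableSpace E] [BorelSpace E] (μ : Measure E)
    [μ.IsAddHaarMeasure] {Ω : Set E} (hΩ : IsOpen Ω) (hb : Bornology.IsBounded Ω)
    {p r : NNReal} (hp : 1 ≤ p) (hpn : p < Module.finrank ℝ E)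
    (hpr : p⁻¹ - (Module.finrank ℝ E : ℝ)⁻¹ ≤ (r : ℝ)⁻¹) :
    ∃ C : NNReal, ∀ u : E → ℝ, ContDiffOn ℝ 2 u (closure Ω) → (∀ x ∈ frontier Ω, u x = 0) →
      eLpNorm u r (μ.restrict Ω) ≤ C * eLpNorm (fderiv ℝ u) p (μ.restrict Ω) := by
  obtain ⟨h, K, hC, h0, -, hK, h2⟩ := exists_truncation
  set A : NNReal := eLpNormLESNormFDerivOfLeConst ℝ μ Ω p r
  refine ⟨A * K.toNNReal, fun u hu hz => ?_⟩
  have hk : ∀ k : ℕ, eLpNorm (fun x => ((k + 1 : ℝ))⁻¹ * h ((k + 1) * Ω.indicator u x)) r μ ≤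
      (A * K.toNNReal : NNReal) * eLpNorm (fderiv ℝ u) p (μ.restrict Ω) := by
    intro k
    have hc : (0 : ℝ) < k + 1 := by positivity
    obtain ⟨w1, w2, w3, w4⟩ := contDiff_truncation hC h0 hΩ hu hz hc
    set w := fun x => ((k + 1 : ℝ))⁻¹ * h ((k + 1) * Ω.indicator u x)
    clear_value w
    have hS := eLpNorm_le_eLpNorm_fderiv_of_le μ w1 ((subset_tsupport w).trans w4) hp hpn hpr hb
    have hf : eLpNorm (fderiv ℝ w) p μ ≤
        ENNReal.ofReal K * eLpNorm (fderiv ℝ u) p (μ.restrict Ω) := by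
      have h3 : eLpNorm (fderiv ℝ w) p μ = eLpNorm (fderiv ℝ w) p (μ.restrict Ω) := by
        have h4 : Function.support (fun x => ‖fderiv ℝ w x‖) ⊆ Ω :=
          Function.support_subset_iff'.2 fun x hx => by rw [w3 x hx, norm_zero]
        rw [← eLpNorm_norm, ← eLpNorm_restrict_eq_of_support_subset h4, eLpNorm_norm]
      rw [h3]
      refine eLpNorm_le_mul_eLpNorm_of_ae_le_mul ((ae_restrict_iff' hΩ.measurableSet).2
        (Eventually.of_forall fun x hx => ?_)) _
      rw [w2 x hx, norm_smul]
      exact mul_le_mul_of_nonneg_right (hK _) (norm_nonneg _)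
    rw [ENNReal.coe_mul, mul_assoc]
    exact hS.trans (mul_le_mul_right hf _)
  rw [← eLpNorm_indicator_eq_eLpNorm_restrict hΩ.measurableSet]
  refine (Lp.eLpNorm_lim_le_liminf_eLpNorm (f := fun (k : ℕ) x =>
    ((k + 1 : ℝ))⁻¹ * h ((k + 1) * Ω.indicator u x)) (fun k => ?_) _
    (Eventually.of_forall fun x => ?_)).trans ?_
  · exact (contDiff_truncation hC h0 hΩ hu hz
      (show (0 : ℝ) < k + 1 by positivity)).1.continuous.aestronglyMeasurable
  · rcases eq_or_ne (Ω.indicator u x) 0 with h3 | h3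
    · simp [h3, h0]
    · refine tendsto_const_nhds.congr' ?_
      filter_upwards [(tendsto_abs_natCast_add_one_mul h3).eventually_gt_atTop 2] with k hk
      rw [(h2 _ hk).1, inv_mul_cancel_left₀ (by positivity)]
  · exact (liminf_le_liminf (Eventually.of_forall hk)).trans (by simp)

/-- Sobolev's inequality for functions vanishing on the boundary of a bounded open set, in a
subcritical form adapted to gradients with `L^s` components, `s ≥ n`. -/
lemma exists_sobolev_const {n : ℕ} (hn : 2 ≤ n) {Ω : Set (Fin n → ℝ)} (hΩ : IsOpen Ω)
    (hb : Bornology.IsBounded Ω) {r s : ℝ} (hr : 2 ≤ r) (hs : n ≤ s) :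
    ∃ C : ℝ, 0 ≤ C ∧ ∀ u : (Fin n → ℝ) → ℝ, ContDiffOn ℝ 2 u (closure Ω) →
      (∀ x ∈ frontier Ω, u x = 0) →
      (∫ x in Ω, |u x| ^ r) ^ (1 / r) ≤
        C * (∑ i : Fin n, ∫ x in Ω, |fderiv ℝ u x (Pi.single i 1)| ^ s) ^ (1 / s) := by
  have hn' : (2 : ℝ) ≤ n := by exact_mod_cast hn
  have hs0 : 0 < s := by linarith
  have hr0 : 0 < r := by linarith
  set p : ℝ := n * r / (n + r) with hp
  have hp1 : 1 ≤ p := by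
    rw [hp, le_div_iff₀ (by positivity)]; nlinarith
  have hpn : p < n := by
    rw [hp, div_lt_iff₀ (by positivity)]; nlinarith
  have hp0 : 0 < p := by linarith
  set p' : NNReal := p.toNNReal with hp'
  set r' : NNReal := r.toNNReal with hr'
  set μ : Measure (Fin n → ℝ) := volume.restrict Ω with hμ
  have hfin : IsFiniteMeasure μ := ⟨by simpa [hμ] using hb.measure_lt_top⟩
  obtain ⟨A, hA⟩ := exists_eLpNorm_le_eLpNorm_fderiv (volume : Measure (Fin n → ℝ)) hΩ hb
    (p := p') (r := r') (by rw [← NNReal.coe_le_coe, Real.coe_toNNReal p hp0.le]; exact hp1)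
    (by rw [← NNReal.coe_lt_coe, Real.coe_toNNReal p hp0.le]; simpa using hpn) (by
      rw [NNReal.coe_inv, Real.coe_toNNReal p hp0.le, Real.coe_toNNReal r hr0.le,
        Module.finrank_fin_fun, hp]
      have : (n : ℝ) ≠ 0 := by positivity
      refine le_of_eq ?_
      field_simp
      ring)
  set V : ENNReal := μ univ ^ (1 / p - 1 / s) with hV
  have hVtop : V ≠ ⊤ := by
    refine ENNReal.rpow_ne_top_of_nonneg ?_ (measure_ne_top _ _)
    have : 1 / s ≤ 1 / p := one_div_le_one_div_of_le hp0 (by linarith)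
    linarith
  set B : ENNReal := A * (n * V) with hB
  have hBtop : B ≠ ⊤ := by
    exact ENNReal.mul_ne_top ENNReal.coe_ne_top
      (ENNReal.mul_ne_top (ENNReal.natCast_ne_top n) hVtop)
  refine ⟨B.toReal, ENNReal.toReal_nonneg, fun u hu hz => ?_⟩
  set T : ℝ := ∑ i : Fin n, ∫ x in Ω, |fderiv ℝ u x (Pi.single i 1)| ^ s with hT
  have hT0 : ∀ i : Fin n, 0 ≤ ∫ x in Ω, |fderiv ℝ u x (Pi.single i 1)| ^ s := fun i =>
    integral_nonneg fun x => by positivity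
  have hTnn : 0 ≤ T := Finset.sum_nonneg fun i _ => hT0 i
  have hu' := hu.mono subset_closure
  have hDm : ∀ i : Fin n, AEStronglyMeasurable (fun x => fderiv ℝ u x (Pi.single i 1)) μ :=
    fun i => (contDiffOn_fderiv_apply hΩ hu' _).continuousOn.aestronglyMeasurable
      hΩ.measurableSet
  have hDL : ∀ i : Fin n, MemLp (fun x => fderiv ℝ u x (Pi.single i 1)) (ENNReal.ofReal s) μ :=
    fun i => memLp_comp_jet hΩ hb hu (Pi.single i 1) (Φ := fun z => z.2.1) (by fun_prop) _
  have huL : MemLp u (ENNReal.ofReal r) μ :=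
    memLp_comp_jet hΩ hb hu 0 (Φ := fun z => z.1) (by fun_prop) _
  set g : (Fin n → ℝ) → ℝ := fun x => ∑ i : Fin n, |fderiv ℝ u x (Pi.single i 1)| with hg
  have hgm : AEStronglyMeasurable g μ :=
    Finset.aestronglyMeasurable_fun_sum _ fun i _ => (hDm i).norm
  have hgs : eLpNorm g (ENNReal.ofReal s) μ ≤ n * ENNReal.ofReal (T ^ (1 / s)) := by
    have hgsum : g = ∑ i : Fin n, fun x => |fderiv ℝ u x (Pi.single i 1)| := by
      ext x; simp [hg]
    rw [hgsum]
    refine (eLpNorm_sum_le (fun i _ => (hDm i).norm) (by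
      rw [← ENNReal.ofReal_one]; exact ENNReal.ofReal_le_ofReal (by linarith))).trans ?_
    refine (Finset.sum_le_card_nsmul _ _ (ENNReal.ofReal (T ^ (1 / s))) fun i _ => ?_).trans ?_
    · rw [eLpNorm_norm, eLpNorm_ofReal_eq hs0 (hDL i)]
      refine ENNReal.ofReal_le_ofReal (rpow_le_rpow (hT0 i) ?_ (by positivity))
      exact Finset.single_le_sum (fun i _ => hT0 i) (Finset.mem_univ i)
    · simp
  have hgp : eLpNorm g p' μ ≤ n * V * ENNReal.ofReal (T ^ (1 / s)) := by
    have hps : (p' : ENNReal) ≤ ENNReal.ofReal s := ENNReal.ofReal_le_ofReal (by linarith)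
    have h3 := eLpNorm_le_eLpNorm_mul_rpow_measure_univ hps hgm
    rw [ENNReal.toReal_ofReal hs0.le, ENNReal.coe_toReal, Real.coe_toNNReal p hp0.le] at h3
    refine h3.trans ?_
    calc _ ≤ n * ENNReal.ofReal (T ^ (1 / s)) * V := by gcongr
      _ = _ := by ring
  have hlim : eLpNorm u (ENNReal.ofReal r) μ ≤ B * ENNReal.ofReal (T ^ (1 / s)) := by
    have hfg : eLpNorm (fderiv ℝ u) p' μ ≤ eLpNorm g p' μ :=
      eLpNorm_mono_real fun x => norm_le_sum_abs_apply_single _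
    refine (hA u hu hz).trans ((mul_le_mul_right (hfg.trans hgp) _).trans (le_of_eq ?_))
    rw [hB]
    ring
  rw [eLpNorm_ofReal_eq hr0 huL, ← ENNReal.ofReal_toReal hBtop,
    ← ENNReal.ofReal_mul ENNReal.toReal_nonneg] at hlim
  exact (ENNReal.ofReal_le_ofReal_iff (by positivity)).1 hlim

end Sobolev

section Interpolation

/-- `∫ |∂ₑu|^(2q) ≤ (2q-1)^q (∫ |u|^α |∂ₑ²u|^β)^(q/β) (∫ |u|^r)^((β-q)/β)`, where
`r = q(β-α)/(β-q)`. -/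
lemma integral_abs_fderiv_rpow_le_mul {E : Type*} [NormedAddCommGroup E] [NormedSpace ℝ E]
    [FiniteDimensional ℝ E] [MeasurableSpace E] [BorelSpace E] (μ : Measure E)
    [μ.IsAddHaarMeasure] {Ω : Set E} {u : E → ℝ} (hΩ : IsOpen Ω)
    (hb : Bornology.IsBounded Ω) (hu : ContDiffOn ℝ 2 u (closure Ω))
    (hz : ∀ x ∈ frontier Ω, u x = 0) (e : E) {α β q : ℝ} (hα : 0 ≤ α) (hαβ : α < β)
    (hq : 1 < q) (hqβ : q < β) :
    ∫ x in Ω, |fderiv ℝ u x e| ^ (2 * q) ∂μ ≤ (2 * q - 1) ^ q *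
      ((∫ x in Ω, |u x| ^ α * |fderiv ℝ (fun y => fderiv ℝ u y e) x e| ^ β ∂μ) ^ (q / β) *
        (∫ x in Ω, |u x| ^ (q * (β - α) / (β - q)) ∂μ) ^ ((β - q) / β)) := by
  set D : E → ℝ := fun x => fderiv ℝ u x e with hD
  set H : E → ℝ := fun x => fderiv ℝ D x e with hH
  have hβ : 0 < β := by linarith
  have hβq : 0 < β - q := by linarith
  have hmem : ∀ {Φ : ℝ × ℝ × ℝ → ℝ}, Continuous Φ → ∀ p : ENNReal,
      MemLp (fun x => Φ (u x, D x, H x)) p (μ.restrict Ω) := fun hΦ p =>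
    memLp_comp_jet hΩ hb hu e hΦ p
  have hrpow : ∀ {a : ℝ}, 0 ≤ a → Continuous fun t : ℝ => |t| ^ a := fun ha =>
    continuous_abs.rpow_const fun _ => Or.inr ha
  set X := ∫ x in Ω, |D x| ^ (2 * q) ∂μ with hX
  set Y := ∫ x in Ω, (|u x| * |H x|) ^ q ∂μ with hY
  have hX0 : 0 ≤ X := integral_nonneg fun x => by positivity
  have hY0 : 0 ≤ Y := integral_nonneg fun x => by positivity
  have hXY : X ≤ (2 * q - 1) ^ q * Y := by
    have h1 := integral_abs_fderiv_rpow_le μ hΩ hb hu hz e (m := 2 * q - 2) (by linarith)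
    have hconj : q.HolderConjugate (q / (q - 1)) := Real.HolderConjugate.conjExponent hq
    have h2 := integral_mul_le_Lp_mul_Lq_of_nonneg (μ := μ.restrict Ω) hconj
      (f := fun x => |u x| * |H x|) (g := fun x => |D x| ^ (2 * q - 2))
      (Eventually.of_forall fun x => by positivity) (Eventually.of_forall fun x => by positivity)
      (hmem (Φ := fun z => |z.1| * |z.2.2|) (by fun_prop) _)
      (hmem (Φ := fun z => |z.2.1| ^ (2 * q - 2))
        ((hrpow (by linarith)).comp (by fun_prop)) _)
    have h3 : ∀ x, (|D x| ^ (2 * q - 2)) ^ (q / (q - 1)) = |D x| ^ (2 * q) := by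
      intro x
      rw [← rpow_mul (abs_nonneg _)]
      congr 1
      have : q - 1 ≠ 0 := by linarith
      field_simp
    simp only [h3] at h2
    have h4 : X ≤ (2 * q - 1) * (Y ^ (1 / q) * X ^ (1 / (q / (q - 1)))) := by
      rw [sub_add_cancel] at h1
      refine h1.trans ?_
      rw [show 2 * q - 2 + 1 = 2 * q - 1 by ring]
      refine mul_le_mul_of_nonneg_left (le_trans (le_of_eq ?_) h2) (by linarith)
      refine integral_congr_ae (Eventually.of_forall fun x => ?_)
      simp only [hH, hD]
      ring
    rcases hX0.eq_or_lt with h5 | h5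
    · rw [← h5]
      exact mul_nonneg (rpow_nonneg (by linarith) _) hY0
    · have h6 : X ^ (1 / q) ≤ (2 * q - 1) * Y ^ (1 / q) := by
        have h7 : X = X ^ (1 / q) * X ^ (1 / (q / (q - 1))) := by
          rw [← rpow_add h5]
          have : 1 / q + 1 / (q / (q - 1)) = 1 := by field_simp; ring
          rw [this, rpow_one]
        have h8 : 0 < X ^ (1 / (q / (q - 1))) := rpow_pos_of_pos h5 _
        refine le_of_mul_le_mul_right ?_ h8
        rw [← h7]
        linarith
      have h9 := rpow_le_rpow (by positivity) h6 (show 0 ≤ q by linarith)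
      rw [mul_rpow (by linarith) (by positivity), ← rpow_mul hX0, ← rpow_mul hY0,
        one_div_mul_cancel (by linarith), rpow_one, rpow_one] at h9
      exact h9
  refine hXY.trans (mul_le_mul_of_nonneg_left ?_ (rpow_nonneg (by linarith) _))
  have hconj : (β / q).HolderConjugate (β / (β - q)) := by
    rw [Real.holderConjugate_iff]
    refine ⟨by rw [lt_div_iff₀ (by linarith)]; linarith, ?_⟩
    field_simp
    ring
  have hα' : 0 ≤ α * q / β := by positivity
  have hc' : 0 ≤ q * (β - α) / β := by
    have : 0 < β - α := by linarith
    positivity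
  have h2 := integral_mul_le_Lp_mul_Lq_of_nonneg (μ := μ.restrict Ω) hconj
    (f := fun x => |u x| ^ (α * q / β) * |H x| ^ q) (g := fun x => |u x| ^ (q * (β - α) / β))
    (Eventually.of_forall fun x => by positivity) (Eventually.of_forall fun x => by positivity)
    (hmem (Φ := fun z => |z.1| ^ (α * q / β) * |z.2.2| ^ q)
      (((hrpow hα').comp (by fun_prop)).mul
        ((hrpow (by linarith)).comp (by fun_prop))) _)
    (hmem (Φ := fun z => |z.1| ^ (q * (β - α) / β)) ((hrpow hc').comp (by fun_prop)) _)
  have e1 : ∀ x, |u x| ^ (α * q / β) * |H x| ^ q * |u x| ^ (q * (β - α) / β) =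
      (|u x| * |H x|) ^ q := by
    intro x
    rw [mul_right_comm, ← rpow_add_of_nonneg (abs_nonneg _) hα' hc',
      mul_rpow (abs_nonneg _) (abs_nonneg _)]
    congr 2
    field_simp
    ring
  have e2 : ∀ x, (|u x| ^ (α * q / β) * |H x| ^ q) ^ (β / q) = |u x| ^ α * |H x| ^ β := by
    intro x
    rw [mul_rpow (by positivity) (by positivity), ← rpow_mul (abs_nonneg _),
      ← rpow_mul (abs_nonneg _)]
    congr 2 <;> field_simp
  have e3 : ∀ x, (|u x| ^ (q * (β - α) / β)) ^ (β / (β - q)) =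
      |u x| ^ (q * (β - α) / (β - q)) := by
    intro x
    rw [← rpow_mul (abs_nonneg _)]
    congr 1
    field_simp
  simp only [e1, e2, e3, one_div_div] at h2
  exact h2

/-- Absorbing the lower-order power `T^((β-α)/(2β))`. -/
lemma rpow_le_of_le_mul_rpow {T S A α β q : ℝ} (hT : 0 ≤ T) (hS : 0 ≤ S) (hA : 0 ≤ A)
    (hα : 0 ≤ α) (hβ : 0 < β) (hq : 0 < q)
    (h : T ≤ A * S ^ (q / β) * T ^ ((β - α) / (2 * β))) :
    T ^ (1 / (2 * q)) ≤ A ^ (β / (q * (α + β))) * S ^ (1 / (α + β)) := by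
  rcases hT.eq_or_lt with h0 | h0
  · rw [← h0, zero_rpow (by positivity)]
    positivity
  · have h1 : T ^ ((α + β) / (2 * β)) ≤ A * S ^ (q / β) := by
      refine le_of_mul_le_mul_right ?_ (rpow_pos_of_pos h0 ((β - α) / (2 * β)))
      rw [← rpow_add h0]
      have : (α + β) / (2 * β) + (β - α) / (2 * β) = 1 := by field_simp; ring
      rwa [this, rpow_one]
    have h2 := rpow_le_rpow (by positivity) h1 (show 0 ≤ β / (q * (α + β)) by positivity)
    rw [mul_rpow hA (by positivity), ← rpow_mul hT, ← rpow_mul hS] at h2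
    have e1 : (α + β) / (2 * β) * (β / (q * (α + β))) = 1 / (2 * q) := by field_simp
    have e2 : q / β * (β / (q * (α + β))) = 1 / (α + β) := by field_simp
    rwa [e1, e2] at h2

end Interpolation

/-- Theorem 3.2, case (i): Let `Ω ⊂ ℝⁿ` be a bounded domain with
(Lipschitz) boundary, `β > α ≥ 0`, `β ≥ 2`, `α + β = n`, and `1 ≤ p < 2β`.  There is
`C > 0` such that for all `u ∈ C²(Ω̄)` with `u` and `∇u` vanishing on `∂Ω` and
every `i`, `‖D_i u‖_{L^p(Ω)} ≤ C([u]_{S̊₂} + 1)`, where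
`[u]_{S̊₂} = (∑ i ∫_Ω |u|^α |D_i² u|^β)^{1/(α+β)}`.  In particular
`S̊_{2,α,β}(Ω) ⊂ W₀^{1,p}(Ω)`. -/
theorem stmt_8 (n : ℕ) (hn : 2 ≤ n) (Ω : Set (Fin n → ℝ))
    (hΩ_open : IsOpen Ω) (hΩ_bdd : Bornology.IsBounded Ω) (hΩ_conn : IsConnected Ω)
    (α β p : ℝ) (hα : 0 ≤ α) (hαβ : α < β) (hβ : 2 ≤ β) (hαβn : α + β = (n : ℝ))
    (hp₁ : 1 ≤ p) (hp₂ : p < 2 * β) :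
    ∃ C : ℝ, 0 < C ∧
      ∀ u : (Fin n → ℝ) → ℝ, ContDiffOn ℝ 2 u (closure Ω) →
        (∀ x ∈ frontier Ω, u x = 0) → (∀ x ∈ frontier Ω, fderiv ℝ u x = 0) →
        ∀ i : Fin n,
        (∫ x in Ω, |fderiv ℝ u x (Pi.single i 1)| ^ p) ^ (1 / p) ≤
          C * ((∑ j : Fin n, ∫ x in Ω, |u x| ^ α *
            |fderiv ℝ (fun y => fderiv ℝ u y (Pi.single j 1)) x (Pi.single j 1)| ^ β)
            ^ (1 / (α + β)) + 1) := by
  have hn' : (2 : ℝ) ≤ n := by exact_mod_cast hn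
  have hn0 : 0 < α + β := by linarith
  obtain ⟨q, hq1, hqβ⟩ := exists_between (show max p n / 2 < β by
    rw [div_lt_iff₀ two_pos, max_lt_iff]; constructor <;> linarith)
  have hpq : p ≤ 2 * q := by linarith [le_max_left p (n : ℝ)]
  have hnq : (n : ℝ) ≤ 2 * q := by linarith [le_max_right p (n : ℝ)]
  have hq : 1 < q := by linarith [le_max_right p (n : ℝ)]
  have hβq : 0 < β - q := by linarith
  have hβα : 0 < β - α := by linarith
  set r : ℝ := q * (β - α) / (β - q) with hr
  have hr2 : 2 ≤ r := by
    rw [hr, le_div_iff₀ hβq]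
    nlinarith
  obtain ⟨C, hC0, hC⟩ := exists_sobolev_const hn hΩ_open hΩ_bdd hr2 hnq
  set μ : Measure (Fin n → ℝ) := volume.restrict Ω with hμ
  have hfin : IsFiniteMeasure μ := ⟨by simpa [hμ] using hΩ_bdd.measure_lt_top⟩
  set A : ℝ := n * (2 * q - 1) ^ q * C ^ (q * (β - α) / β) with hA
  have h2q : 0 < 2 * q - 1 := by linarith
  have hA0 : 0 ≤ A := by positivity
  set V : ENNReal := μ univ ^ (1 / p - 1 / (2 * q)) with hV
  have hVtop : V ≠ ⊤ := by
    refine ENNReal.rpow_ne_top_of_nonneg ?_ (measure_ne_top _ _)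
    have : 1 / (2 * q) ≤ 1 / p := one_div_le_one_div_of_le (by linarith) hpq
    linarith
  refine ⟨A ^ (β / (q * (α + β))) * V.toReal + 1, by positivity, fun u hu hz _ i => ?_⟩
  set S : ℝ := ∑ j : Fin n, ∫ x in Ω, |u x| ^ α *
    |fderiv ℝ (fun y => fderiv ℝ u y (Pi.single j 1)) x (Pi.single j 1)| ^ β with hS
  set T : ℝ := ∑ j : Fin n, ∫ x in Ω, |fderiv ℝ u x (Pi.single j 1)| ^ (2 * q) with hT
  set U : ℝ := ∫ x in Ω, |u x| ^ r with hU
  have hSj : ∀ j : Fin n, 0 ≤ ∫ x in Ω, |u x| ^ α *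
      |fderiv ℝ (fun y => fderiv ℝ u y (Pi.single j 1)) x (Pi.single j 1)| ^ β := fun j =>
    integral_nonneg fun x => by positivity
  have hTj : ∀ j : Fin n, 0 ≤ ∫ x in Ω, |fderiv ℝ u x (Pi.single j 1)| ^ (2 * q) := fun j =>
    integral_nonneg fun x => by positivity
  have hS0 : 0 ≤ S := Finset.sum_nonneg fun j _ => hSj j
  have hT0 : 0 ≤ T := Finset.sum_nonneg fun j _ => hTj j
  have hU0 : 0 ≤ U := integral_nonneg fun x => by positivity
  have hUT : U ^ ((β - q) / β) ≤ C ^ (q * (β - α) / β) * T ^ ((β - α) / (2 * β)) := by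
    have h1 := rpow_le_rpow (by positivity) (hC u hu hz)
      (show 0 ≤ q * (β - α) / β by positivity)
    rw [mul_rpow hC0 (by positivity), ← rpow_mul hU0, ← rpow_mul hT0] at h1
    have e1 : 1 / r * (q * (β - α) / β) = (β - q) / β := by rw [hr]; field_simp
    have e2 : 1 / (2 * q) * (q * (β - α) / β) = (β - α) / (2 * β) := by field_simp
    rwa [e1, e2] at h1
  have hTS : T ≤ A * S ^ (q / β) * T ^ ((β - α) / (2 * β)) := by
    have h1 : ∀ j ∈ Finset.univ, ∫ x in Ω, |fderiv ℝ u x (Pi.single j 1)| ^ (2 * q) ≤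
        (2 * q - 1) ^ q * (S ^ (q / β) *
          (C ^ (q * (β - α) / β) * T ^ ((β - α) / (2 * β)))) := by
      intro j _
      refine (integral_abs_fderiv_rpow_le_mul volume hΩ_open hΩ_bdd hu hz (Pi.single j 1)
        hα hαβ hq hqβ).trans ?_
      gcongr
      exact Finset.single_le_sum (fun j _ => hSj j) (Finset.mem_univ j)
    refine (Finset.sum_le_card_nsmul _ _ _ h1).trans (le_of_eq ?_)
    rw [Finset.card_univ, Fintype.card_fin, nsmul_eq_mul, hA]
    ring
  have hTfin := rpow_le_of_le_mul_rpow hT0 hS0 hA0 hα (by linarith) (by linarith) hTS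
  have hmem : ∀ s : ENNReal, MemLp (fun x => fderiv ℝ u x (Pi.single i 1)) s μ := fun s =>
    memLp_comp_jet hΩ_open hΩ_bdd hu (Pi.single i 1) (Φ := fun z => z.2.1) (by fun_prop) s
  have hp0 : 0 < p := by linarith
  have hq0 : 0 < 2 * q := by linarith
  have hcmp := eLpNorm_le_eLpNorm_mul_rpow_measure_univ (ENNReal.ofReal_le_ofReal hpq)
    (hmem 1).aestronglyMeasurable
  rw [ENNReal.toReal_ofReal hp0.le, ENNReal.toReal_ofReal hq0.le,
    eLpNorm_ofReal_eq hp0 (hmem _), eLpNorm_ofReal_eq hq0 (hmem _), ← hV,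
    ← ENNReal.ofReal_toReal hVtop, ← ENNReal.ofReal_mul (rpow_nonneg (hTj i) _),
    ENNReal.ofReal_le_ofReal_iff (mul_nonneg (rpow_nonneg (hTj i) _) ENNReal.toReal_nonneg)] at hcmp
  have hX : (∫ x in Ω, |fderiv ℝ u x (Pi.single i 1)| ^ (2 * q)) ^ (1 / (2 * q)) ≤
      T ^ (1 / (2 * q)) :=
    rpow_le_rpow (hTj i) (Finset.single_le_sum (fun j _ => hTj j) (Finset.mem_univ i))
      (by positivity)
  have hSn : 0 ≤ S ^ (1 / (α + β)) := by positivity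
  have hAn : 0 ≤ A ^ (β / (q * (α + β))) * V.toReal := by positivity
  calc _ ≤ _ := hcmp
    _ ≤ A ^ (β / (q * (α + β))) * S ^ (1 / (α + β)) * V.toReal := by
      gcongr
      exact hX.trans hTfin
    _ ≤ (A ^ (β / (q * (α + β))) * V.toReal + 1) * (S ^ (1 / (α + β)) + 1) := by nlinarith
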